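/- The 3-CNF formula φ is satisfiable (i.e., there exists a Boolean assignment a ∈ {0,1}^p satisfying φ) if and only if the Lebesgue integral ∫_{ℝ^p} f_φ(x)² dx (valued in [0,∞]) is strictly positive. -/

import Mathlib

open MeasureTheory

noncomputable def f0 (ε x : ℝ) : ℝ :=
  ε⁻¹ * (max 0 (x + ε) - 2 * max 0 x + max 0 (x - ε))

noncomputable def f1 (ε x : ℝ) : ℝ := f0 ε (x - 1)

/-- A literal over `p` Boolean variables: a variable index and a polarity. -/
structure Lit (p : ℕ) where
  idx : Fin p
  pos : Bool

/-- Value of a literal on a real input: `f1` for a positive literal, `f0` for a negated one. -/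
noncomputable def litVal (ε : ℝ) {p : ℕ} (L : Lit p) (x : Fin p → ℝ) : ℝ :=
  if L.pos then f1 ε (x L.idx) else f0 ε (x L.idx)

/-- Clause function `g_j(x) = Σ_{k=1}^{3} f0(ℓ₁(x) + ℓ₂(x) + ℓ₃(x) − k)`. -/
noncomputable def clauseVal (ε : ℝ) {p : ℕ} (C : Fin 3 → Lit p) (x : Fin p → ℝ) : ℝ :=
  ∑ k ∈ Finset.Icc (1 : ℕ) 3, f0 ε ((∑ t, litVal ε (C t) x) - (k : ℝ))

/-- Formula function `f_φ(x) = f0(Σ_{j=1}^{c} g_j(x) − c)`. -/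
noncomputable def cnfVal (ε : ℝ) {p c : ℕ} (φ : Fin c → Fin 3 → Lit p) (x : Fin p → ℝ) : ℝ :=
  f0 ε ((∑ j, clauseVal ε (φ j) x) - (c : ℝ))

/-- A Boolean assignment satisfies `φ` if every clause has a true literal. -/
def Satisfies {p c : ℕ} (a : Fin p → Bool) (φ : Fin c → Fin 3 → Lit p) : Prop :=
  ∀ j, ∃ t, a (φ j t).idx = (φ j t).pos

/-- Real embedding of a Boolean assignment. -/
noncomputable def embed {p : ℕ} (a : Fin p → Bool) : Fin p → ℝ :=
  fun i => if a i then 1 else 0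

lemma f0_eq_zero {ε x : ℝ} (hε : 0 < ε) (hx : ε ≤ |x|) : f0 ε x = 0 := by
  unfold f0
  rcases le_abs.1 hx with h | h
  · rw [max_eq_right (by linarith), max_eq_right (by linarith), max_eq_right (by linarith)]
    ring
  · rw [max_eq_left (by linarith), max_eq_left (by linarith), max_eq_left (by linarith)]
    ring

lemma abs_lt_of_f0_ne_zero {ε x : ℝ} (hε : 0 < ε) (h : f0 ε x ≠ 0) : |x| < ε := by
  by_contra! hx
  exact h (f0_eq_zero hε hx)

lemma f0_zero {ε : ℝ} (hε : 0 < ε) : f0 ε 0 = 1 := by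
  unfold f0
  rw [max_eq_right (by linarith), max_self, max_eq_left (by linarith)]
  field_simp
  ring

lemma f0_le_one {ε : ℝ} (hε : 0 < ε) (x : ℝ) : f0 ε x ≤ 1 := by
  unfold f0
  rw [inv_mul_le_iff₀ hε]
  rcases max_cases 0 (x + ε) with h1 | h1 <;> rcases max_cases 0 x with h2 | h2 <;>
    rcases max_cases 0 (x - ε) with h3 | h3 <;> linarith

lemma continuous_f0 (ε : ℝ) : Continuous (f0 ε) := by
  unfold f0
  fun_prop

lemma continuous_litVal (ε : ℝ) {p : ℕ} (L : Lit p) : Continuous (litVal ε L) := by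
  have := continuous_f0 ε
  unfold litVal f1
  split_ifs <;> fun_prop

lemma continuous_cnfVal (ε : ℝ) {p c : ℕ} (φ : Fin c → Fin 3 → Lit p) :
    Continuous (cnfVal ε φ) := by
  have h0 := continuous_f0 ε
  have hL := fun L : Lit p => continuous_litVal ε L
  unfold cnfVal clauseVal
  fun_prop

lemma clauseVal_eq (ε : ℝ) {p : ℕ} (C : Fin 3 → Lit p) (x : Fin p → ℝ) :
    clauseVal ε C x = f0 ε ((∑ t, litVal ε (C t) x) - 1) + f0 ε ((∑ t, litVal ε (C t) x) - 2)
      + f0 ε ((∑ t, litVal ε (C t) x) - 3) := by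
  simp [clauseVal, show Finset.Icc (1 : ℕ) 3 = {1, 2, 3} from rfl, add_assoc]

lemma clauseVal_le_one {ε : ℝ} (hε : 0 < ε) (hε' : ε < 1 / 2) {p : ℕ} (C : Fin 3 → Lit p)
    (x : Fin p → ℝ) : clauseVal ε C x ≤ 1 := by
  rw [clauseVal_eq]
  generalize ∑ t, litVal ε (C t) x = s
  rcases le_total s (3 / 2) with h | h
  · rw [f0_eq_zero (x := s - 2) hε (le_abs.2 (by right; linarith)),
      f0_eq_zero (x := s - 3) hε (le_abs.2 (by right; linarith))]
    linarith [f0_le_one hε (s - 1)]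
  rw [f0_eq_zero (x := s - 1) hε (le_abs.2 (by left; linarith))]
  rcases le_total s (5 / 2) with h' | h'
  · rw [f0_eq_zero (x := s - 3) hε (le_abs.2 (by right; linarith))]
    linarith [f0_le_one hε (s - 2)]
  · rw [f0_eq_zero (x := s - 2) hε (le_abs.2 (by left; linarith))]
    linarith [f0_le_one hε (s - 3)]

lemma exists_litVal_pos {ε : ℝ} (hε : 0 < ε) (hε' : ε < 1 / 2) {p : ℕ} {C : Fin 3 → Lit p}
    {x : Fin p → ℝ} (h : 0 < clauseVal ε C x) : ∃ t, 0 < litVal ε (C t) x := by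
  by_contra! hn
  have hs : ∑ t, litVal ε (C t) x ≤ 0 := Finset.sum_nonpos fun t _ => hn t
  rw [clauseVal_eq, f0_eq_zero hε (le_abs.2 (by right; linarith)),
    f0_eq_zero hε (le_abs.2 (by right; linarith)),
    f0_eq_zero hε (le_abs.2 (by right; linarith))] at h
  simp at h

lemma decide_eq_of_litVal_pos {ε : ℝ} (hε : 0 < ε) (hε' : ε < 1 / 2) {p : ℕ} {L : Lit p}
    {x : Fin p → ℝ} (h : 0 < litVal ε L x) : decide (1 / 2 < x L.idx) = L.pos := by
  unfold litVal f1 at h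
  split_ifs at h with hp
  · have := (abs_lt.1 (abs_lt_of_f0_ne_zero hε h.ne')).1
    rw [hp, decide_eq_true_iff]
    linarith
  · have := (abs_lt.1 (abs_lt_of_f0_ne_zero hε h.ne')).2
    rw [Bool.eq_false_of_not_eq_true hp, decide_eq_false_iff_not]
    linarith

lemma litVal_embed {ε : ℝ} (hε : 0 < ε) (hε' : ε < 1 / 2) {p : ℕ} (L : Lit p)
    (a : Fin p → Bool) : litVal ε L (embed a) = if a L.idx = L.pos then 1 else 0 := by
  have h1 : f0 ε 1 = 0 := f0_eq_zero hε (le_abs.2 (by left; linarith))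
  have h2 : f0 ε (-1) = 0 := f0_eq_zero hε (le_abs.2 (by right; linarith))
  unfold litVal f1 embed
  cases a L.idx <;> cases L.pos <;> simp [f0_zero hε, h1, h2]

lemma clauseVal_embed {ε : ℝ} (hε : 0 < ε) (hε' : ε < 1 / 2) {p : ℕ} {C : Fin 3 → Lit p}
    {a : Fin p → Bool} (h : ∃ t, a (C t).idx = (C t).pos) : clauseVal ε C (embed a) = 1 := by
  have h1 : f0 ε 1 = 0 := f0_eq_zero hε (le_abs.2 (by left; linarith))
  have h2 : f0 ε 2 = 0 := f0_eq_zero hε (le_abs.2 (by left; linarith))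
  have h3 : f0 ε (-1) = 0 := f0_eq_zero hε (le_abs.2 (by right; linarith))
  have h4 : f0 ε (-2) = 0 := f0_eq_zero hε (le_abs.2 (by right; linarith))
  rw [clauseVal_eq]
  simp only [litVal_embed hε hε', Fin.sum_univ_three]
  rw [Fin.exists_fin_succ, Fin.exists_fin_two] at h
  change a (C 0).idx = (C 0).pos ∨ a (C 1).idx = (C 1).pos ∨ a (C 2).idx = (C 2).pos at h
  split_ifs <;> first | (exfalso; tauto) | (norm_num [f0_zero hε, h1, h2, h3, h4])

lemma cnfVal_embed {ε : ℝ} (hε : 0 < ε) (hε' : ε < 1 / 2) {p c : ℕ}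
    {φ : Fin c → Fin 3 → Lit p} {a : Fin p → Bool} (h : Satisfies a φ) :
    cnfVal ε φ (embed a) = 1 := by
  simp [cnfVal, fun j => clauseVal_embed hε hε' (h j), f0_zero hε]

lemma satisfies_of_cnfVal_ne_zero {ε : ℝ} (hε : 0 < ε) (hε' : ε < 1 / 2) {p c : ℕ}
    {φ : Fin c → Fin 3 → Lit p} {x : Fin p → ℝ} (h : cnfVal ε φ x ≠ 0) :
    Satisfies (fun i => decide (1 / 2 < x i)) φ := by
  intro j
  have hsum := (abs_lt.1 (abs_lt_of_f0_ne_zero hε h)).1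
  have hj : 1 - clauseVal ε (φ j) x ≤ ∑ i, (1 - clauseVal ε (φ i) x) :=
    Finset.single_le_sum (f := fun i => 1 - clauseVal ε (φ i) x)
      (fun i _ => sub_nonneg.2 (clauseVal_le_one hε hε' (φ i) x)) (Finset.mem_univ j)
  simp only [Finset.sum_sub_distrib, Finset.sum_const, Finset.card_univ, Fintype.card_fin,
    nsmul_eq_mul, mul_one] at hj
  obtain ⟨t, ht⟩ := exists_litVal_pos (C := φ j) (x := x) hε hε' (by linarith)
  exact ⟨t, decide_eq_of_litVal_pos hε hε' ht⟩

theorem stmt9 (ε : ℝ) (hε : 0 < ε) (hε' : ε < 1 / 2)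
    (p c : ℕ) (φ : Fin c → Fin 3 → Lit p) :
    (∃ a : Fin p → Bool, Satisfies a φ) ↔
      0 < ∫⁻ x : Fin p → ℝ, ENNReal.ofReal ((cnfVal ε φ x) ^ 2) := by
  have hcont : Continuous fun x : Fin p → ℝ => ENNReal.ofReal ((cnfVal ε φ x) ^ 2) :=
    ENNReal.continuous_ofReal.comp ((continuous_cnfVal ε φ).pow 2)
  rw [lintegral_pos_iff_support hcont.measurable]
  constructor
  · rintro ⟨a, ha⟩
    refine hcont.isOpen_support.measure_pos volume ⟨embed a, ?_⟩
    simp [cnfVal_embed hε hε' ha]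
  · intro h
    obtain ⟨x, hx⟩ := nonempty_of_measure_ne_zero h.ne'
    refine ⟨_, satisfies_of_cnfVal_ne_zero (x := x) hε hε' fun h0 => hx ?_⟩
    simp [h0]
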